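/- arXiv:2002.07176 — 2 statements merged into one kernel-verified Lean document; each statement's English description precedes it below -/
import Mathlib

section
/- On R^3 with coordinates (x_1, x_2, y) of weights 1, 1, 3, the linear map D on g_{<0}(h) defined by D(x_1∂_y) = ∂_{x_2}, D(x_2∂_y) = ∂_{x_1}, D(x_1²∂_y) = 2x_1∂_{x_2}, D(x_2²∂_y) = 2x_2∂_{x_1}, D(x_1x_2∂_y) = x_1∂_{x_1} + x_2∂_{x_2}, and D = 0 on the remaining homogeneous basis vectors (∂_{x_1}, ∂_{x_2}, ∂_y), is a Lie algebra derivation of g_{<0}(h) of weight 1 that vanishes on all coordinate vector fields and hence is not of the form [Z,·] for a vector field Z. -/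
open MvPolynomial

/-- Polynomial vector fields on ℝⁿ, given by their coefficient polynomials. -/
abbrev VF (n : ℕ) := Fin n → MvPolynomial (Fin n) ℝ

/-- Lie bracket of polynomial vector fields. -/
noncomputable def bracket {n : ℕ} (V W : VF n) : VF n :=
  fun i => ∑ j, (V j * pderiv j (W i) - W j * pderiv j (V i))

/-- The weight (Euler) vector field ∇ʰ = Σᵢ rᵢ xⁱ ∂ᵢ of the dilation with weights r. -/
noncomputable def nabla {n : ℕ} (r : Fin n → ℕ) : VF n :=
  fun i => (r i : MvPolynomial (Fin n) ℝ) * X i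

/-- A polynomial vector field is homogeneous of weight `a` w.r.t. the dilation `r`. -/
def IsHomog {n : ℕ} (r : Fin n → ℕ) (a : ℤ) (V : VF n) : Prop :=
  bracket (nabla r) V = fun i => (a : ℝ) • V i

/-- The coordinate vector field ∂ᵢ. -/
noncomputable def coordVF {n : ℕ} (i : Fin n) : VF n := fun k => if k = i then 1 else 0

/-- The vector field f ∂ⱼ. -/
noncomputable def vfOf {n : ℕ} (f : MvPolynomial (Fin n) ℝ) (j : Fin n) : VF n :=
  fun k => if k = j then f else 0

/-- 𝔪 = g₋(h): the span of homogeneous polynomial vector fields of negative weight. -/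
noncomputable def negPart {n : ℕ} (r : Fin n → ℕ) : Submodule ℝ (VF n) :=
  Submodule.span ℝ {V : VF n | ∃ k : ℤ, k < 0 ∧ IsHomog r k V}

def r113 : Fin 3 → ℕ := ![1, 1, 3]

/-- The general element of `negPart r113`. -/
noncomputable def negVF (a b c d e f g h : ℝ) : VF 3 :=
  ![C a, C b, C c + C d * X 0 + C e * X 1 + C f * X 0 ^ 2 + C g * (X 0 * X 1) + C h * X 1 ^ 2]

/-- The image of `negVF a b c d e f g h` under the derivation. -/
noncomputable def imageVF (d e f g h : ℝ) : VF 3 :=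
  ![C e + C g * X 0 + C (2 * h) * X 1, C d + C (2 * f) * X 0 + C g * X 1, 0]

lemma coeff_X_mul_pderiv {σ R : Type*} [CommSemiring R] (j : σ) (p : MvPolynomial σ R)
    (m : σ →₀ ℕ) : coeff m (X j * pderiv j p) = m j * coeff m p := by
  classical
  induction p using MvPolynomial.induction_on' with
  | monomial u a =>
    rw [X_mul_pderiv_monomial, coeff_smul, coeff_monomial]
    split_ifs with hu
    · rw [hu, nsmul_eq_mul]
    · simp
  | add p q hp hq => rw [map_add, mul_add, coeff_add, hp, hq, coeff_add, mul_add]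

lemma pderiv_two {σ R : Type*} [CommSemiring R] (i : σ) :
    pderiv i (2 : MvPolynomial σ R) = 0 := by
  rw [← map_ofNat C 2, pderiv_C]

lemma bracket_nabla {n : ℕ} (r : Fin n → ℕ) (V : VF n) (i : Fin n) :
    bracket (nabla r) V i =
      ∑ j, (r j : MvPolynomial (Fin n) ℝ) * (X j * pderiv j (V i)) - r i * V i := by
  have hder : ∀ j, pderiv j ((r i : MvPolynomial (Fin n) ℝ) * X i) =
      if j = i then (r i : MvPolynomial (Fin n) ℝ) else 0 := by
    intro j
    rw [Derivation.leibniz]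
    by_cases hj : j = i
    · subst hj; simp
    · simp [pderiv_X_of_ne (Ne.symm hj), hj]
  simp only [bracket, nabla, Finset.sum_sub_distrib, hder, mul_ite, mul_zero,
    Finset.sum_ite_eq', Finset.mem_univ, if_true, mul_assoc, mul_comm (V i)]

lemma IsHomog.coeff_eq {n : ℕ} {r : Fin n → ℕ} {k : ℤ} {V : VF n} (hV : IsHomog r k V)
    (i : Fin n) (m : Fin n →₀ ℕ) :
    (∑ j, (r j : ℝ) * m j - r i - k) * coeff m (V i) = 0 := by
  have hc := congrArg (coeff m) ((bracket_nabla r V i).symm.trans (congrFun hV i))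
  have hcast : ∀ (l : ℕ) (p : MvPolynomial (Fin n) ℝ),
      coeff m ((l : MvPolynomial (Fin n) ℝ) * p) = l * coeff m p := by
    intro l p
    rw [← map_natCast C, coeff_C_mul]
  simp only [coeff_sub, coeff_sum, hcast, coeff_X_mul_pderiv, coeff_smul, smul_eq_mul] at hc
  simp only [← mul_assoc, ← Finset.sum_mul] at hc
  linear_combination hc

lemma IsHomog.coeff_r113 {k : ℤ} {V : VF 3} (hV : IsHomog r113 k V) (i : Fin 3)
    (m : Fin 3 →₀ ℕ) :
    ((m 0 + m 1 + 3 * m 2 : ℝ) - r113 i - k) * coeff m (V i) = 0 := by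
  have hc := hV.coeff_eq i m
  simp only [Fin.sum_univ_three] at hc
  simpa [r113] using hc

lemma IsHomog.weight_eq {k : ℤ} {V : VF 3} (hV : IsHomog r113 k V) {i : Fin 3}
    {m : Fin 3 →₀ ℕ} (hm : coeff m (V i) ≠ 0) :
    (m 0 + m 1 + 3 * m 2 : ℤ) = r113 i + k := by
  have hc := (mul_eq_zero.mp (hV.coeff_r113 i m)).resolve_right hm
  have : (m 0 + m 1 + 3 * m 2 : ℝ) = r113 i + k := by linear_combination hc
  exact_mod_cast this

/-- The exponent of the monomial `x₁ᵃ x₂ᵇ`. -/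
noncomputable def planeExp (t : ℕ × ℕ) : Fin 3 →₀ ℕ :=
  Finsupp.single 0 t.1 + Finsupp.single 1 t.2

@[simp] lemma planeExp_zero (t : ℕ × ℕ) : planeExp t 0 = t.1 := by simp [planeExp]

@[simp] lemma planeExp_one (t : ℕ × ℕ) : planeExp t 1 = t.2 := by simp [planeExp]

@[simp] lemma planeExp_two (t : ℕ × ℕ) : planeExp t 2 = 0 := by simp [planeExp]

lemma planeExp_injective : Function.Injective planeExp := by
  intro s t hst
  ext
  · simpa using DFunLike.congr_fun hst 0
  · simpa using DFunLike.congr_fun hst 1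

lemma monomial_planeExp (t : ℕ × ℕ) (a : ℝ) :
    monomial (planeExp t) a = C a * (X 0 ^ t.1 * X 1 ^ t.2) := by
  rw [planeExp, X_pow_eq_monomial, X_pow_eq_monomial, monomial_mul, C_mul_monomial]
  simp

lemma eq_sum_of_support {p : MvPolynomial (Fin 3) ℝ} (T : Finset (ℕ × ℕ))
    (hp : ∀ m, coeff m p ≠ 0 → m 2 = 0 ∧ (m 0, m 1) ∈ T) :
    p = ∑ t ∈ T, C (coeff (planeExp t) p) * (X 0 ^ t.1 * X 1 ^ t.2) := by
  classical
  simp only [← monomial_planeExp]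
  rw [← Finset.sum_image (f := fun m => monomial m (coeff m p)) planeExp_injective.injOn]
  conv_lhs => rw [← support_sum_monomial_coeff p]
  refine Finset.sum_subset (fun m hm => ?_) (fun m _ hm => ?_)
  · obtain ⟨h2, hT⟩ := hp m (mem_support_iff.mp hm)
    refine Finset.mem_image.mpr ⟨_, hT, ?_⟩
    ext i
    fin_cases i <;> simp [h2]
  · rw [notMem_support_iff.mp hm, monomial_zero]

lemma IsHomog.eq_negVF {k : ℤ} (hk : k < 0) {V : VF 3} (hV : IsHomog r113 k V) :
    ∃ a b c d e f g h : ℝ, V = negVF a b c d e f g h ∧ ((k : ℝ) + 2) * d = 0 ∧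
      ((k : ℝ) + 2) * e = 0 ∧ ((k : ℝ) + 1) * f = 0 ∧ ((k : ℝ) + 1) * g = 0 ∧
      ((k : ℝ) + 1) * h = 0 := by
  refine ⟨coeff (planeExp (0, 0)) (V 0), coeff (planeExp (0, 0)) (V 1),
    coeff (planeExp (0, 0)) (V 2), coeff (planeExp (1, 0)) (V 2), coeff (planeExp (0, 1)) (V 2),
    coeff (planeExp (2, 0)) (V 2), coeff (planeExp (1, 1)) (V 2), coeff (planeExp (0, 2)) (V 2),
    ?_, ?_, ?_, ?_, ?_, ?_⟩
  · have e0 := eq_sum_of_support (p := V 0) {(0, 0)} fun m hm => by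
      have := hV.weight_eq hm
      simp [r113] at this ⊢
      omega
    have e1 := eq_sum_of_support (p := V 1) {(0, 0)} fun m hm => by
      have := hV.weight_eq hm
      simp [r113] at this ⊢
      omega
    have e2 := eq_sum_of_support (p := V 2) {(0, 0), (1, 0), (0, 1), (2, 0), (1, 1), (0, 2)}
      fun m hm => by
        have := hV.weight_eq hm
        simp [r113] at this ⊢
        omega
    funext i
    fin_cases i
    · simpa [negVF] using e0
    · simpa [negVF] using e1
    · refine e2.trans ?_
      simp [negVF]
      ring
  · have hc := hV.coeff_r113 2 (planeExp (1, 0))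
    simp only [planeExp_zero, planeExp_one, planeExp_two, r113, Matrix.cons_val] at hc
    push_cast at hc
    linear_combination -hc
  · have hc := hV.coeff_r113 2 (planeExp (0, 1))
    simp only [planeExp_zero, planeExp_one, planeExp_two, r113, Matrix.cons_val] at hc
    push_cast at hc
    linear_combination -hc
  · have hc := hV.coeff_r113 2 (planeExp (2, 0))
    simp only [planeExp_zero, planeExp_one, planeExp_two, r113, Matrix.cons_val] at hc
    push_cast at hc
    linear_combination -hc
  · have hc := hV.coeff_r113 2 (planeExp (1, 1))
    simp only [planeExp_zero, planeExp_one, planeExp_two, r113, Matrix.cons_val] at hc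
    push_cast at hc
    linear_combination -hc
  · have hc := hV.coeff_r113 2 (planeExp (0, 2))
    simp only [planeExp_zero, planeExp_one, planeExp_two, r113, Matrix.cons_val] at hc
    push_cast at hc
    linear_combination -hc

lemma exists_eq_negVF {V : VF 3} (hV : V ∈ negPart r113) :
    ∃ a b c d e f g h : ℝ, V = negVF a b c d e f g h := by
  induction hV using Submodule.span_induction with
  | mem V hV =>
    obtain ⟨k, hk, hV⟩ := hV
    obtain ⟨a, b, c, d, e, f, g, h, rfl, -⟩ := hV.eq_negVF hk
    exact ⟨a, b, c, d, e, f, g, h, rfl⟩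
  | zero =>
    refine ⟨0, 0, 0, 0, 0, 0, 0, 0, ?_⟩
    funext i
    fin_cases i <;> simp [negVF]
  | add V W _ _ hV hW =>
    obtain ⟨a, b, c, d, e, f, g, h, rfl⟩ := hV
    obtain ⟨a', b', c', d', e', f', g', h', rfl⟩ := hW
    refine ⟨a + a', b + b', c + c', d + d', e + e', f + f', g + g', h + h', ?_⟩
    funext i
    fin_cases i <;> simp [negVF]
    ring
  | smul s V _ hV =>
    obtain ⟨a, b, c, d, e, f, g, h, rfl⟩ := hV
    refine ⟨s * a, s * b, s * c, s * d, s * e, s * f, s * g, s * h, ?_⟩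
    funext i
    fin_cases i <;> simp [negVF, smul_eq_C_mul]
    ring

lemma bracket_negVF (a b c d e f g h a' b' c' d' e' f' g' h' : ℝ) :
    bracket (negVF a b c d e f g h) (negVF a' b' c' d' e' f' g' h') =
      negVF 0 0 (a * d' + b * e' - a' * d - b' * e)
        (2 * a * f' + b * g' - 2 * a' * f - b' * g)
        (a * g' + 2 * b * h' - a' * g - 2 * b' * h) 0 0 0 := by
  funext i
  fin_cases i <;>
    simp [bracket, negVF, Fin.sum_univ_three, pderiv_X, Pi.single_apply, Derivation.leibniz,
      Derivation.leibniz_pow, map_ofNat]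
  ring

lemma bracket_imageVF_add (a b c d e f g h a' b' c' d' e' f' g' h' : ℝ) :
    bracket (imageVF d e f g h) (negVF a' b' c' d' e' f' g' h') +
        bracket (negVF a b c d e f g h) (imageVF d' e' f' g' h') =
      imageVF (2 * a * f' + b * g' - 2 * a' * f - b' * g)
        (a * g' + 2 * b * h' - a' * g - 2 * b' * h) 0 0 0 := by
  funext i
  fin_cases i <;>
    simp [bracket, negVF, imageVF, Fin.sum_univ_three, pderiv_X, Pi.single_apply,
      Derivation.leibniz, Derivation.leibniz_pow, map_ofNat, pderiv_two] <;>
    ring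

lemma isHomog_imageVF {k : ℤ} {d e f g h : ℝ} (hd : ((k : ℝ) + 2) * d = 0)
    (he : ((k : ℝ) + 2) * e = 0) (hf : ((k : ℝ) + 1) * f = 0) (hg : ((k : ℝ) + 1) * g = 0)
    (hh : ((k : ℝ) + 1) * h = 0) : IsHomog r113 (k + 1) (imageVF d e f g h) := by
  have lift : ∀ {x : ℝ}, x = 0 → (C x : MvPolynomial (Fin 3) ℝ) = 0 := by
    rintro x rfl; exact C_0
  have hd := lift hd
  have he := lift he
  have hf := lift hf
  have hg := lift hg
  have hh := lift hh
  simp only [C_mul, C_add, C_1, map_ofNat] at hd he hf hg hh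
  funext i
  fin_cases i <;>
    simp [bracket_nabla, imageVF, Fin.sum_univ_three, pderiv_X, Pi.single_apply,
      Derivation.leibniz, r113, smul_eq_C_mul, map_ofNat, pderiv_two,
      -map_intCast]
  · linear_combination -he - hg * X 0 - 2 * hh * X 1
  · linear_combination -hd - 2 * hf * X 0 - hg * X 1

lemma coordVF_mem_negPart (i : Fin 3) : coordVF i ∈ negPart r113 := by
  refine Submodule.subset_span ⟨-r113 i, by fin_cases i <;> simp [r113], ?_⟩
  funext j
  fin_cases i <;> fin_cases j <;>
    simp [bracket_nabla, coordVF, r113, smul_eq_C_mul, map_ofNat]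

lemma vfOf_X_zero_mem_negPart : vfOf (X 0) 2 ∈ negPart r113 := by
  refine Submodule.subset_span ⟨-2, by norm_num, ?_⟩
  funext j
  fin_cases j <;>
    simp [bracket_nabla, vfOf, r113, smul_eq_C_mul, map_ofNat, pderiv_X,
      Pi.single_apply]
  ring

/-- On ℝ³ with coordinates `(x₁, x₂, y)` of weights `1, 1, 3`
(`x₁ = x₀, x₂ = x₁, y = x₂`), the linear map `D` on `g₋(h)` with
`D(x₁∂_y) = ∂_{x₂}`, `D(x₂∂_y) = ∂_{x₁}`, `D(x₁²∂_y) = 2x₁∂_{x₂}`,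
`D(x₂²∂_y) = 2x₂∂_{x₁}`, `D(x₁x₂∂_y) = x₁∂_{x₁} + x₂∂_{x₂}`, and `D = 0` on the
remaining basis vectors `∂_{x₁}, ∂_{x₂}, ∂_y`, is a derivation of `g₋(h)` of weight `1`
vanishing on all coordinate vector fields, hence not of the form `[Z,·]`. -/
theorem example_weights_113
    (D : VF 3 → VF 3)
    (hadd : ∀ V W, D (V + W) = D V + D W)
    (hsmul : ∀ (c : ℝ) V, D (c • V) = c • D V)
    (h1 : D (vfOf (X 0) 2) = coordVF 1)
    (h2 : D (vfOf (X 1) 2) = coordVF 0)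
    (h3 : D (vfOf (X 0 ^ 2) 2) = vfOf (C 2 * X 0) 1)
    (h4 : D (vfOf (X 1 ^ 2) 2) = vfOf (C 2 * X 1) 0)
    (h5 : D (vfOf (X 0 * X 1) 2) = vfOf (X 0) 0 + vfOf (X 1) 1)
    (h6 : D (coordVF 0) = 0) (h7 : D (coordVF 1) = 0) (h8 : D (coordVF 2) = 0) :
    (∀ V ∈ negPart r113, ∀ W ∈ negPart r113,
      D (bracket V W) = bracket (D V) W + bracket V (D W)) ∧
    (∀ (k : ℤ) V, k < 0 → IsHomog r113 k V → IsHomog r113 (k + 1) (D V)) ∧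
    ¬ ∃ Z : VF 3, ∀ V ∈ negPart r113, D V = bracket Z V := by
  have hD : ∀ a b c d e f g h : ℝ, D (negVF a b c d e f g h) = imageVF d e f g h := by
    intro a b c d e f g h
    have hdecomp : negVF a b c d e f g h = a • coordVF 0 + b • coordVF 1 + c • coordVF 2 +
        d • vfOf (X 0) 2 + e • vfOf (X 1) 2 + f • vfOf (X 0 ^ 2) 2 +
        g • vfOf (X 0 * X 1) 2 + h • vfOf (X 1 ^ 2) 2 := by
      funext i
      fin_cases i <;> simp [negVF, coordVF, vfOf, smul_eq_C_mul]
    rw [hdecomp]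
    simp only [hadd, hsmul, h1, h2, h3, h4, h5, h6, h7, h8]
    funext i
    fin_cases i <;> simp [imageVF, coordVF, vfOf, smul_eq_C_mul] <;> ring
  refine ⟨fun V hV W hW => ?_, fun k V hk hV => ?_, ?_⟩
  · obtain ⟨a, b, c, d, e, f, g, h, rfl⟩ := exists_eq_negVF hV
    obtain ⟨a', b', c', d', e', f', g', h', rfl⟩ := exists_eq_negVF hW
    rw [bracket_negVF, hD, hD, hD, bracket_imageVF_add]
  · obtain ⟨a, b, c, d, e, f, g, h, rfl, hd, he, hf, hg, hh⟩ := hV.eq_negVF hk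
    rw [hD]
    exact isHomog_imageVF hd he hf hg hh
  · rintro ⟨Z, hZ⟩
    have hy := congrFun (hZ _ (coordVF_mem_negPart 2)) 1
    have hx := congrFun (hZ _ vfOf_X_zero_mem_negPart) 1
    rw [h8] at hy
    rw [h1] at hx
    simp [bracket, coordVF] at hy
    simp [bracket, coordVF, vfOf, hy] at hx
end

section
/- Let h be a dilation on R^n with ordered weights r_1 ≤ ... ≤ r_n and suppose r_n < 2r_{n-1}. Then every graded derivation of weight 0 of the nilpotent Lie algebra 𝔪 = g_{<0}(h) is of the form ad_Z for some polynomial vector field Z of weight 0; i.e., the degree-0 Tanaka prolongation of 𝔪 equals g_0(h). -/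
open MvPolynomial

/-- The derivation `f ↦ Σⱼ Vⱼ ∂ⱼ f` defined by a polynomial vector field. -/
noncomputable abbrev vfDer {n : ℕ} (V : VF n) :
    Derivation ℝ (MvPolynomial (Fin n) ℝ) (MvPolynomial (Fin n) ℝ) :=
  mkDerivationEquiv ℝ V

lemma vfDer_X {n : ℕ} (V : VF n) (i : Fin n) : vfDer V (X i) = V i :=
  mkDerivation_X ℝ V i

lemma vfDer_apply {n : ℕ} (V : VF n) (f : MvPolynomial (Fin n) ℝ) :
    vfDer V f = ∑ j, V j * pderiv j f := by
  have hsum : ∀ g, (∑ j, V j • pderiv j : Derivation ℝ (MvPolynomial (Fin n) ℝ)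
      (MvPolynomial (Fin n) ℝ)) g = ∑ j, V j * pderiv j g := fun g => by
    rw [← Derivation.coeFnAddMonoidHom_apply, map_sum, Finset.sum_apply]
    rfl
  have h : vfDer V = ∑ j, V j • pderiv j := by
    refine derivation_ext fun i => ?_
    rw [vfDer_X, hsum]
    simp [pderiv_X, Pi.single_apply]
  rw [h, hsum]

lemma bracket_apply {n : ℕ} (V W : VF n) (i : Fin n) :
    bracket V W i = vfDer V (W i) - vfDer W (V i) := by
  simp only [bracket, vfDer_apply, Finset.sum_sub_distrib]

lemma vfDer_bracket {n : ℕ} (V W : VF n) : vfDer (bracket V W) = ⁅vfDer V, vfDer W⁆ := by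
  refine derivation_ext fun i => ?_
  rw [vfDer_X, bracket_apply, Derivation.commutator_apply, vfDer_X, vfDer_X]

lemma bracket_add_right {n : ℕ} (U V W : VF n) :
    bracket U (V + W) = bracket U V + bracket U W := by
  funext i
  simp only [bracket_apply, Pi.add_apply, map_add, Derivation.add_apply]
  abel

lemma bracket_smul_right {n : ℕ} (c : ℝ) (V W : VF n) :
    bracket V (c • W) = c • bracket V W := by
  funext i
  simp only [bracket_apply, Pi.smul_apply, Derivation.map_smul, map_smul, Derivation.smul_apply,
    smul_sub]

lemma bracket_skew {n : ℕ} (V W : VF n) : bracket V W = - bracket W V := by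
  funext i
  rw [Pi.neg_apply, bracket_apply, bracket_apply, neg_sub]

lemma bracket_smul_left {n : ℕ} (c : ℝ) (V W : VF n) :
    bracket (c • V) W = c • bracket V W := by
  rw [bracket_skew, bracket_smul_right, bracket_skew V, smul_neg]

lemma bracket_sub_right {n : ℕ} (U V W : VF n) :
    bracket U (V - W) = bracket U V - bracket U W := by
  rw [eq_sub_iff_add_eq, ← bracket_add_right, sub_add_cancel]

lemma bracket_sub_left {n : ℕ} (U V W : VF n) :
    bracket (U - V) W = bracket U W - bracket V W := by
  rw [bracket_skew, bracket_sub_right, bracket_skew U, bracket_skew V]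
  abel

lemma bracket_zero_right {n : ℕ} (V : VF n) : bracket V 0 = 0 := by
  simpa using bracket_sub_right V 0 0

lemma bracket_zero_left {n : ℕ} (V : VF n) : bracket 0 V = 0 := by
  rw [bracket_skew, bracket_zero_right, neg_zero]

lemma bracket_jacobi {n : ℕ} (U V W : VF n) :
    bracket U (bracket V W) = bracket (bracket U V) W + bracket V (bracket U W) := by
  funext i
  simp only [bracket_apply, Pi.add_apply, vfDer_bracket, Derivation.commutator_apply, map_sub]
  abel

lemma IsHomog.bracket {n : ℕ} {r : Fin n → ℕ} {a b : ℤ} {V W : VF n}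
    (hV : IsHomog r a V) (hW : IsHomog r b W) : IsHomog r (a + b) (bracket V W) := by
  have hV' : _root_.bracket (nabla r) V = (a : ℝ) • V := hV
  have hW' : _root_.bracket (nabla r) W = (b : ℝ) • W := hW
  change _root_.bracket (nabla r) (_root_.bracket V W) =
    ((a + b : ℤ) : ℝ) • _root_.bracket V W
  rw [bracket_jacobi, hV', hW', bracket_smul_left, bracket_smul_right, ← add_smul]
  push_cast
  rfl

lemma IsHomog.sub {n : ℕ} {r : Fin n → ℕ} {a : ℤ} {V W : VF n}
    (hV : IsHomog r a V) (hW : IsHomog r a W) : IsHomog r a (V - W) := by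
  have hV' : _root_.bracket (nabla r) V = (a : ℝ) • V := hV
  have hW' : _root_.bracket (nabla r) W = (a : ℝ) • W := hW
  change _root_.bracket (nabla r) (V - W) = (a : ℝ) • (V - W)
  rw [bracket_sub_right, hV', hW', smul_sub]

lemma vfDer_nabla_apply {n : ℕ} (r : Fin n → ℕ) (f : MvPolynomial (Fin n) ℝ) :
    vfDer (nabla r) f = ∑ j, (r j : ℝ) • (X j * pderiv j f) := by
  simp only [vfDer_apply, nabla, smul_eq_C_mul, map_natCast, mul_assoc]

lemma isHomog_iff {n : ℕ} {r : Fin n → ℕ} {a : ℤ} {V : VF n} :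
    IsHomog r a V ↔ ∀ i, vfDer (nabla r) (V i) = ((a : ℝ) + r i) • V i := by
  rw [IsHomog, funext_iff]
  refine forall_congr' fun i => ?_
  have h : vfDer V (nabla r i) = (r i : ℝ) • V i := by
    have : nabla r i = (r i : ℝ) • X i := by
      simp only [nabla, smul_eq_C_mul, map_natCast]
    rw [this, Derivation.map_smul, vfDer_X]
  rw [bracket_apply, h, sub_eq_iff_eq_add, add_smul]

lemma IsHomog.mem_negPart {n : ℕ} {r : Fin n → ℕ} {a : ℤ} {V : VF n}
    (hV : IsHomog r a V) (ha : a < 0) : V ∈ negPart r :=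
  Submodule.subset_span ⟨a, ha, hV⟩

lemma coeff_vfDer_nabla {n : ℕ} (r : Fin n → ℕ) (f : MvPolynomial (Fin n) ℝ)
    (d : Fin n →₀ ℕ) :
    coeff d (vfDer (nabla r) f) = (∑ j, (r j : ℝ) * d j) * coeff d f := by
  induction f using MvPolynomial.monomial_add_induction_on with
  | C a => simp [derivation_C, coeff_C]; rintro rfl; simp
  | monomial_add s a f _ _ ih =>
    rw [map_add, coeff_add, coeff_add, ih, mul_add, vfDer_nabla_apply]
    congr 1
    simp only [X_mul_pderiv_monomial, coeff_sum, coeff_smul, coeff_monomial, Finset.sum_mul]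
    refine Finset.sum_congr rfl fun j _ => ?_
    split_ifs with h
    · subst h; simp [mul_assoc]
    · simp

/-- An eigenfunction of the Euler field with nonpositive eigenvalue is constant. -/
lemma eq_C_of_vfDer_nabla {n : ℕ} {r : Fin n → ℕ} (hr : ∀ i, 0 < r i)
    {f : MvPolynomial (Fin n) ℝ} {q : ℝ} (hq : q ≤ 0) (hf : vfDer (nabla r) f = q • f) :
    f = C (coeff 0 f) := by
  ext d
  rw [coeff_C]
  split_ifs with h
  · rw [h]
  · have h1 := coeff_vfDer_nabla r f d
    rw [hf, coeff_smul, smul_eq_mul] at h1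
    obtain ⟨i, hi⟩ : ∃ i, d i ≠ 0 := by
      by_contra! h2
      exact h (Finsupp.ext fun i => (h2 i).symm)
    have h2 : 0 < ∑ j, (r j : ℝ) * d j :=
      Finset.sum_pos' (fun j _ => by positivity)
        ⟨i, Finset.mem_univ i, mul_pos (by exact_mod_cast hr i)
          (by exact_mod_cast Nat.pos_of_ne_zero hi)⟩
    have h3 : (q - ∑ j, (r j : ℝ) * d j) * coeff d f = 0 := by linear_combination h1
    exact (mul_eq_zero.mp h3).resolve_left (by linarith)

/-- A homogeneous field with constant coefficients has no component whose weight is not minus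
its own. -/
lemma IsHomog.apply_eq_zero {n : ℕ} {r : Fin n → ℕ} {a : ℤ} {V : VF n} (hV : IsHomog r a V)
    (hc : ∀ i k, pderiv i (V k) = 0) {k : Fin n} (hk : a + r k ≠ 0) : V k = 0 := by
  have h := isHomog_iff.mp hV k
  simp only [vfDer_apply, hc, mul_zero, Finset.sum_const_zero] at h
  exact (smul_eq_zero.mp h.symm).resolve_left (by exact_mod_cast hk)

lemma vfDer_coordVF {n : ℕ} (i : Fin n) (f : MvPolynomial (Fin n) ℝ) :
    vfDer (coordVF i) f = pderiv i f := by
  simp [vfDer_apply, coordVF]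

lemma vfDer_coordVF_apply {n : ℕ} (V : VF n) (i k : Fin n) : vfDer V (coordVF i k) = 0 := by
  unfold coordVF
  split_ifs <;> simp

lemma bracket_coordVF_left {n : ℕ} (i : Fin n) (V : VF n) :
    bracket (coordVF i) V = fun k => pderiv i (V k) := by
  funext k
  rw [bracket_apply, vfDer_coordVF, vfDer_coordVF_apply, sub_zero]

lemma bracket_coordVF_right {n : ℕ} (i : Fin n) (V : VF n) :
    bracket V (coordVF i) = fun k => - pderiv i (V k) := by
  funext k
  rw [bracket_apply, vfDer_coordVF, vfDer_coordVF_apply, zero_sub]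

lemma isHomog_coordVF {n : ℕ} (r : Fin n → ℕ) (i : Fin n) :
    IsHomog r (-(r i : ℤ)) (coordVF i) := by
  rw [isHomog_iff]
  intro k
  rw [vfDer_coordVF_apply, coordVF]
  split_ifs with h
  · subst h; simp
  · simp

lemma isHomog_vfOf_X {n : ℕ} (r : Fin n → ℕ) (i j : Fin n) :
    IsHomog r ((r i : ℤ) - r j) (vfOf (X i) j) := by
  rw [isHomog_iff]
  intro k
  unfold vfOf
  split_ifs with h
  · subst h
    rw [vfDer_X]
    simp [nabla, smul_eq_C_mul]
  · simp

lemma bracket_coordVF_vfOf_X {n : ℕ} (i j m : Fin n) :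
    bracket (coordVF m) (vfOf (X i) j) = if i = m then coordVF j else 0 := by
  rw [bracket_coordVF_left]
  funext k
  unfold vfOf coordVF
  split_ifs <;> simp_all

lemma bracket_vfOf_X_vfOf_X {n : ℕ} (i j k l : Fin n) :
    bracket (vfOf (X i) j) (vfOf (X k) l) =
      (if k = j then vfOf (X i) l else 0) - (if i = l then vfOf (X k) j else 0) := by
  funext m
  rw [bracket_apply, Pi.sub_apply]
  congr 1
  · by_cases h : m = l <;> by_cases h' : k = j <;> simp [vfOf, h, h', vfDer_X]
  · by_cases h : m = j <;> by_cases h' : i = l <;> simp [vfOf, h, h', vfDer_X]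

/-- A vector field with constant coefficients acts on a linear field by contraction. -/
lemma bracket_const_vfOf_X {n : ℕ} {V : VF n} (hV : ∀ i k, pderiv i (V k) = 0) (i j : Fin n) :
    bracket V (vfOf (X i) j) = vfOf (V i) j := by
  funext k
  rw [bracket_apply, vfDer_apply (vfOf (X i) j)]
  simp only [hV, mul_zero, Finset.sum_const_zero, sub_zero]
  by_cases h : k = j
  · simp only [vfOf, h, if_true, vfDer_X]
  · simp only [vfOf, h, if_false, map_zero]

lemma bracket_vfOf_X_const {n : ℕ} {V : VF n} (hV : ∀ i k, pderiv i (V k) = 0) (i j : Fin n) :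
    bracket (vfOf (X i) j) V = - vfOf (V i) j := by
  rw [bracket_skew, bracket_const_vfOf_X hV]

section LinearDerivation

variable {n : ℕ} {r : Fin n → ℕ} {D : VF n →ₗ[ℝ] VF n}

lemma pderiv_map_apply (hr : ∀ i, 0 < r i)
    (hLeib : ∀ V ∈ negPart r, ∀ W ∈ negPart r,
      D (bracket V W) = bracket (D V) W + bracket V (D W))
    (hcoord : ∀ i, D (coordVF i) = 0) {V : VF n} (hV : V ∈ negPart r) (i k : Fin n) :
    pderiv i (D V k) = D (bracket (coordVF i) V) k := by
  have hi : coordVF i ∈ negPart r :=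
    (isHomog_coordVF r i).mem_negPart (by have := hr i; omega)
  rw [hLeib _ hi _ hV, hcoord, bracket_zero_left, zero_add, bracket_coordVF_left]

lemma pderiv_map_vfOf_X (hr : ∀ i, 0 < r i)
    (hLeib : ∀ V ∈ negPart r, ∀ W ∈ negPart r,
      D (bracket V W) = bracket (D V) W + bracket V (D W))
    (hcoord : ∀ i, D (coordVF i) = 0) {i j : Fin n} (hij : r i < r j) (m k : Fin n) :
    pderiv m (D (vfOf (X i) j) k) = 0 := by
  rw [pderiv_map_apply hr hLeib hcoord ((isHomog_vfOf_X r i j).mem_negPart (by omega)),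
    bracket_coordVF_vfOf_X]
  split_ifs
  · rw [hcoord, Pi.zero_apply]
  · rw [map_zero, Pi.zero_apply]

/-- The relation between the contractions of `D (xⁱ ∂ⱼ)` and `D (xᵏ ∂ₗ)` obtained by applying
`D` to `[xⁱ ∂ⱼ, xᵏ ∂ₗ]`. -/
lemma map_bracket_vfOf_X (hr : ∀ i, 0 < r i)
    (hLeib : ∀ V ∈ negPart r, ∀ W ∈ negPart r,
      D (bracket V W) = bracket (D V) W + bracket V (D W))
    (hcoord : ∀ i, D (coordVF i) = 0) {i j k l : Fin n} (hij : r i < r j) (hkl : r k < r l)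
    (hkj : k ≠ j) :
    vfOf (D (vfOf (X i) j) k) l - vfOf (D (vfOf (X k) l) i) j =
      if i = l then - D (vfOf (X k) j) else 0 := by
  have h := hLeib _ ((isHomog_vfOf_X r i j).mem_negPart (by omega)) _
    ((isHomog_vfOf_X r k l).mem_negPart (by omega))
  rw [bracket_const_vfOf_X (pderiv_map_vfOf_X hr hLeib hcoord hij),
    bracket_vfOf_X_const (pderiv_map_vfOf_X hr hLeib hcoord hkl),
    bracket_vfOf_X_vfOf_X, if_neg hkj, zero_sub, map_neg, ← sub_eq_add_neg] at h
  rw [← h]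
  split_ifs <;> simp

/-- If `r N` is the largest weight and `r N < 2 * r p` for some `p ≠ N`, then `D` kills the linear
fields of negative weight. -/
lemma map_vfOf_X_eq_zero (hr : ∀ i, 0 < r i) {p N : Fin n} (hpN : p ≠ N)
    (hN : ∀ i, r i ≤ r N) (hcond : r N < 2 * r p)
    (hweight : ∀ (k : ℤ) V, k < 0 → IsHomog r k V → IsHomog r k (D V))
    (hLeib : ∀ V ∈ negPart r, ∀ W ∈ negPart r,
      D (bracket V W) = bracket (D V) W + bracket V (D W))
    (hcoord : ∀ i, D (coordVF i) = 0) {i j : Fin n} (hij : r i < r j) :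
    D (vfOf (X i) j) = 0 := by
  have key := fun {i j k l : Fin n} (hij : r i < r j) (hkl : r k < r l) (hkj : k ≠ j) (m) =>
    congrFun (map_bracket_vfOf_X hr hLeib hcoord hij hkl hkj) m
  have hne : ∀ {a b : Fin n}, r a < r b → a ≠ b := by rintro a _ h rfl; exact h.false
  have hlow : ∀ i j k, r i < r j → r k < r j → j ≠ N → D (vfOf (X i) j) k = 0 := by
    intro i j k hij hkj hj
    have h := key hij (hkj.trans_le (hN j)) (hne hkj) N
    rw [if_neg (hne (hij.trans_le (hN j)))] at h
    simpa [vfOf, hj.symm] using h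
  have hsymm : ∀ i k, r i < r N → r k < r N →
      D (vfOf (X i) N) k = D (vfOf (X k) N) i := by
    intro i k hi hk
    have h := key hi hk (hne hk) N
    rw [if_neg (hne hi)] at h
    simpa [vfOf, sub_eq_zero] using h
  have htop : ∀ i k, r i < r N → r k < r p → r k < r N → r i + r k = r N →
      D (vfOf (X i) N) k = 0 := by
    intro i k hi hkp hk hik
    have h := key hi hkp (hne hk) p
    by_cases hip : i = p
    · subst hip
      rw [if_pos rfl, Pi.neg_apply, ← hsymm i k hi hk] at h
      simp only [Pi.sub_apply, vfOf, if_true, if_neg hpN, sub_zero] at h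
      exact self_eq_neg.mp h
    · rw [if_neg hip] at h
      simpa [vfOf, hpN] using h
  have hhom := hweight _ _ (by omega) (isHomog_vfOf_X r i j)
  funext k
  by_cases hw : r i + r k = r j
  · have hri := hr i
    by_cases hj : j = N
    · subst hj
      by_cases hkp : r k < r p
      · exact htop i k hij hkp (by omega) hw
      · rw [hsymm i k hij (by omega)]
        exact htop k i (by omega) (by omega) hij (by omega)
    · exact hlow i j k hij (by omega) hj
  · exact hhom.apply_eq_zero (pderiv_map_vfOf_X hr hLeib hcoord hij) (by omega)

/-- If `D` is a derivation of weight zero killing the coordinate fields and the linear fields of negative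
weight, then it kills all homogeneous fields of negative weight. -/
lemma map_eq_zero_of_isHomog (hr : ∀ i, 0 < r i) {N : Fin n} (hN : ∀ i, r i ≤ r N)
    (hweight : ∀ (k : ℤ) V, k < 0 → IsHomog r k V → IsHomog r k (D V))
    (hLeib : ∀ V ∈ negPart r, ∀ W ∈ negPart r,
      D (bracket V W) = bracket (D V) W + bracket V (D W))
    (hcoord : ∀ i, D (coordVF i) = 0)
    (hlin : ∀ i j, r i < r j → D (vfOf (X i) j) = 0) {a : ℤ} (ha : a < 0) {V : VF n}
    (hV : IsHomog r a V) : D V = 0 := by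
  obtain ⟨s, hs⟩ : ∃ s : ℕ, a + r N ≤ s := ⟨(a + r N).toNat, Int.self_le_toNat _⟩
  induction s generalizing a V with
  | zero =>
    have hVC : V = ∑ i, coeff 0 (V i) • coordVF i := by
      funext k
      have hk := hN k
      have hle : (a : ℝ) + r k ≤ 0 := by exact_mod_cast (by omega : a + r k ≤ 0)
      conv_lhs => rw [eq_C_of_vfDer_nabla hr hle (isHomog_iff.mp hV k)]
      simp [Finset.sum_apply, coordVF, smul_eq_C_mul]
    rw [hVC, map_sum]
    exact Finset.sum_eq_zero fun i _ => by rw [map_smul, hcoord, smul_zero]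
  | succ s ih =>
    have hc : ∀ i k, pderiv i (D V k) = 0 := fun i k => by
      have hi := hr i
      rw [pderiv_map_apply hr hLeib hcoord (hV.mem_negPart ha),
        ih (by omega) ((isHomog_coordVF r i).bracket hV) (by push_cast at hs; omega),
        Pi.zero_apply]
    by_cases ha' : a + r N ≤ 0
    · exact ih ha hV (by omega)
    funext c
    by_cases hac : a + r c = 0
    · have hcN : r c < r N := by omega
      have hY := isHomog_vfOf_X r c N
      have h := hLeib _ (hV.mem_negPart ha) _ (hY.mem_negPart (by omega))
      rw [ih (by omega) (hV.bracket hY) (by omega), hlin c N hcN, bracket_zero_right, add_zero,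
        bracket_const_vfOf_X hc] at h
      simpa [vfOf] using (congrFun h N).symm
    · exact (hweight a V ha hV).apply_eq_zero hc hac

end LinearDerivation

/-- Weighted Poincaré lemma: a closed family of homogeneous fields `Yᵢ` of weights `-rᵢ` is of the
form `[Z, ∂ᵢ]` for a field `Z` of weight zero. -/
lemma exists_bracket_coordVF_eq {n : ℕ} {r : Fin n → ℕ} (hr : ∀ i, 0 < r i) (Y : Fin n → VF n)
    (hY : ∀ i, IsHomog r (-(r i : ℤ)) (Y i))
    (hclosed : ∀ i j k, pderiv i (Y j k) = pderiv j (Y i k)) :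
    ∃ Z : VF n, IsHomog r 0 Z ∧ ∀ i, bracket Z (coordVF i) = Y i := by
  set Z : VF n := fun k => -((r k : ℝ)⁻¹ • ∑ i, (r i : ℝ) • (X i * Y i k)) with hZ
  have hd : ∀ j k, pderiv j (Z k) = - Y j k := by
    intro j k
    have hk : (r k : ℝ) ≠ 0 := by exact_mod_cast (hr k).ne'
    have h : pderiv j (∑ i, (r i : ℝ) • (X i * Y i k)) = (r k : ℝ) • Y j k := by
      have hE := isHomog_iff.mp (hY j) k
      rw [vfDer_nabla_apply] at hE
      simp only [map_sum, Derivation.map_smul, pderiv_mul, smul_add, Finset.sum_add_distrib, hclosed j, hE]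
      rw [Finset.sum_eq_single j (fun i _ hij => by simp [pderiv_X_of_ne hij]) (by simp),
        pderiv_X_self, one_mul, ← add_smul]
      push_cast
      congr 1
      ring
    rw [hZ]
    simp only [map_neg, Derivation.map_smul, h, inv_smul_smul₀ hk]
  refine ⟨Z, isHomog_iff.mpr fun k => ?_, fun i => ?_⟩
  · have hk : (r k : ℝ) ≠ 0 := by exact_mod_cast (hr k).ne'
    simp only [vfDer_nabla_apply, hd, Int.cast_zero, zero_add]
    simp only [hZ, smul_neg, smul_inv_smul₀ hk, mul_neg, Finset.sum_neg_distrib]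
  · rw [bracket_coordVF_right]
    funext k
    rw [hd, neg_neg]

/-- If `rₙ < 2rₙ₋₁` (ordered weights on `Fin (n+2)`, top index
`Fin.last (n+1)`, second-to-top `⟨n, _⟩`), then every graded derivation of weight `0`
of `𝔪 = g₋(h)` is `ad_Z` for some polynomial vector field `Z` of weight `0`; i.e. the
degree-0 Tanaka prolongation of `𝔪` equals `g₀(h)`. -/
theorem weight_zero_derivations_inner
    (n : ℕ) (r : Fin (n + 2) → ℕ) (hr : ∀ i, 0 < r i) (hmono : Monotone r)
    (hcond : r (Fin.last (n + 1)) < 2 * r (⟨n, by omega⟩ : Fin (n + 2)))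
    (D : VF (n + 2) → VF (n + 2))
    (hadd : ∀ V W, D (V + W) = D V + D W)
    (hsmul : ∀ (c : ℝ) V, D (c • V) = c • D V)
    (hweight : ∀ (k : ℤ) V, k < 0 → IsHomog r k V → IsHomog r k (D V))
    (hLeib : ∀ V ∈ negPart r, ∀ W ∈ negPart r,
      D (bracket V W) = bracket (D V) W + bracket V (D W)) :
    ∃ Z : VF (n + 2), IsHomog r 0 Z ∧ ∀ V ∈ negPart r, D V = bracket Z V := by
  have hcoordmem : ∀ i, coordVF i ∈ negPart r := fun i =>
    (isHomog_coordVF r i).mem_negPart (by have := hr i; omega)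
  have hcomm : ∀ i j : Fin (n + 2), bracket (coordVF i) (coordVF j) = 0 := fun i j => by
    rw [bracket_coordVF_left]
    funext k
    unfold coordVF
    split_ifs <;> simp
  have hD0 : D 0 = 0 := by simpa using hsmul 0 0
  obtain ⟨Z, hZ0, hZ⟩ := exists_bracket_coordVF_eq hr (fun i => D (coordVF i))
    (fun i => hweight _ _ (by have := hr i; omega) (isHomog_coordVF r i)) (fun i j k => by
      have h := congrFun (hLeib _ (hcoordmem i) _ (hcoordmem j)) k
      rw [hcomm, hD0, bracket_coordVF_left, bracket_coordVF_right] at h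
      simp only [Pi.add_apply, Pi.zero_apply] at h
      linear_combination -h)
  let D' : VF (n + 2) →ₗ[ℝ] VF (n + 2) :=
    { toFun := fun V => D V - bracket Z V
      map_add' := fun V W => by rw [hadd, bracket_add_right]; abel
      map_smul' := fun c V => by
        rw [hsmul, bracket_smul_right, RingHom.id_apply, smul_sub] }
  have hD' : ∀ V, D' V = D V - bracket Z V := fun _ => rfl
  have hweight' : ∀ (k : ℤ) V, k < 0 → IsHomog r k V → IsHomog r k (D' V) :=
    fun k V hk hV => (hweight k V hk hV).sub (by simpa using hZ0.bracket hV)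
  have hLeib' : ∀ V ∈ negPart r, ∀ W ∈ negPart r,
      D' (bracket V W) = bracket (D' V) W + bracket V (D' W) := by
    intro V hV W hW
    rw [hD', hD', hD', hLeib V hV W hW, bracket_jacobi, bracket_sub_left, bracket_sub_right]
    abel
  have hcoord' : ∀ i, D' (coordVF i) = 0 := fun i => by rw [hD', hZ, sub_self]
  have hN : ∀ i, r i ≤ r (Fin.last (n + 1)) := fun i => hmono (Fin.le_last i)
  have hpN : (⟨n, by omega⟩ : Fin (n + 2)) ≠ Fin.last (n + 1) := by simp [Fin.ext_iff]
  have hlin : ∀ i j, r i < r j → D' (vfOf (X i) j) = 0 := fun i j hij =>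
    map_vfOf_X_eq_zero hr hpN hN hcond hweight' hLeib' hcoord' hij
  refine ⟨Z, hZ0, fun V hV => ?_⟩
  have hle : negPart r ≤ LinearMap.ker D' :=
    Submodule.span_le.mpr fun W ⟨k, hk, hW⟩ =>
      map_eq_zero_of_isHomog hr hN hweight' hLeib' hcoord' hlin hk hW
  exact sub_eq_zero.mp (hle hV)
end
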